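/- arXiv:math-ph/0011015 — 2 statements merged into one kernel-verified Lean document; each statement's English description precedes it below -/
import Mathlib

section
/- Let α, κ > 0 and let γ : ℝ → ℝ² satisfy |γ(s) − γ(s')| ≤ |s − s'| for all s, s' ∈ ℝ and assumption (a1), and suppose there exist s, s' ∈ ℝ with |γ(s) − γ(s')| < |s − s'| (the curve is not straight). Then there exists a real-valued Schwartz function ψ on ℝ such that (α/(2π)) ∫_ℝ ∫_ℝ K₀(κ |γ(s) − γ(s')|) ψ(s) ψ(s') ds ds' > (α/(2κ)) ∫_ℝ ψ(s)² ds. In particular, the supremum of the spectrum of the Birman–Schwinger operator R^κ_{α,γ} on L²(ℝ) with integral kernel (α/(2π)) K₀(κ |γ(s) − γ(s')|) is strictly greater than α/(2κ). -/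
open MeasureTheory Real

/-- The Macdonald function `K₀` (modified Bessel function of the second kind, order zero),
`K₀(x) = ∫₀^∞ exp(−x cosh t) dt` for `x > 0`. -/
noncomputable def K0 (x : ℝ) : ℝ := ∫ t in Set.Ioi (0 : ℝ), Real.exp (-x * Real.cosh t)

/-- The plane `ℝ²` with its Euclidean norm. -/
abbrev Plane := EuclideanSpace ℝ (Fin 2)

open Set Filter Topology

namespace BS

lemma pow_gauss (n : ℕ) (x : ℝ) : |x| ^ n * Real.exp (-(x ^ 2 / 2)) ≤ n.factorial * Real.exp 1 := by
  have h1 := Real.pow_div_factorial_le_exp _ (abs_nonneg x) n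
  have hf : (0:ℝ) < n.factorial := by positivity
  rw [div_le_iff₀ hf] at h1
  calc |x| ^ n * Real.exp (-(x ^ 2 / 2)) ≤ (Real.exp |x| * n.factorial) * Real.exp (-(x ^ 2 / 2)) := by
        gcongr
    _ = n.factorial * Real.exp (|x| - x ^ 2 / 2) := by
        rw [sub_eq_add_neg, Real.exp_add]; ring
    _ ≤ n.factorial * Real.exp 1 := by
        gcongr
        rw [← sq_abs]
        nlinarith [sq_nonneg (|x| - 1)]

lemma poly_gauss (p : Polynomial ℝ) :
    ∃ C : ℝ, ∀ x : ℝ, |p.eval x| * Real.exp (-(x ^ 2 / 2)) ≤ C := by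
  induction p using Polynomial.induction_on' with
  | add p q hp hq =>
    obtain ⟨C, hC⟩ := hp
    obtain ⟨D, hD⟩ := hq
    refine ⟨C + D, fun x => ?_⟩
    rw [Polynomial.eval_add]
    have := mul_le_mul_of_nonneg_right (abs_add_le (p.eval x) (q.eval x)) (Real.exp_pos (-(x^2/2))).le
    linarith [hC x, hD x]
  | monomial n a =>
    refine ⟨|a| * (n.factorial * Real.exp 1), fun x => ?_⟩
    rw [Polynomial.eval_monomial, abs_mul, abs_pow, mul_assoc]
    exact mul_le_mul_of_nonneg_left (pow_gauss n x) (abs_nonneg a)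

noncomputable def gaussS : SchwartzMap ℝ ℝ where
  toFun := fun y => Real.exp (-(y ^ 2 / 2))
  smooth' := by fun_prop
  decay' := by
    intro k n
    obtain ⟨C, hC⟩ := poly_gauss (Polynomial.X ^ k * (Polynomial.hermite n).map (algebraMap ℤ ℝ))
    refine ⟨C, fun x => ?_⟩
    rw [norm_iteratedFDeriv_eq_norm_iteratedDeriv, iteratedDeriv_eq_iterate,
      Polynomial.deriv_gaussian_eq_hermite_mul_gaussian]
    refine le_trans (le_of_eq ?_) (hC x)
    rw [Polynomial.eval_mul, Polynomial.eval_pow, Polynomial.eval_X, Polynomial.eval_map_algebraMap]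
    simp only [norm_mul, Real.norm_eq_abs, abs_mul, abs_pow, abs_neg, abs_one, one_pow, one_mul,
      Real.abs_exp]
    ring

lemma exists_schwartz (δ : ℝ) (hδ : 0 < δ) :
    ∃ ψ : SchwartzMap ℝ ℝ, ∀ s, ψ s = Real.exp (-((δ * s) ^ 2 / 2)) := by
  refine ⟨SchwartzMap.compCLMOfContinuousLinearEquiv ℝ
    (ContinuousLinearEquiv.unitsEquivAut ℝ (Units.mk0 δ hδ.ne')) gaussS, fun s => ?_⟩
  rw [SchwartzMap.compCLMOfContinuousLinearEquiv_apply]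
  change Real.exp _ = _
  simp [mul_comm]

lemma hasDeriv_arctan_sinh (t : ℝ) :
    HasDerivAt (fun t => Real.arctan (Real.sinh t)) (1 / Real.cosh t) t := by
  have := (Real.hasDerivAt_sinh t).arctan
  convert this using 1
  have h := Real.cosh_sq t
  have h0 := (Real.cosh_pos t).ne'
  rw [add_comm, ← h]
  field_simp

lemma tendsto_arctan_sinh : Tendsto (fun t => Real.arctan (Real.sinh t)) atTop (𝓝 (π/2)) := by
  have h1 : Tendsto Real.sinh atTop atTop := by
    refine tendsto_atTop_mono' _ ?_ tendsto_id
    filter_upwards [eventually_ge_atTop 0] with t ht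
    exact Real.self_le_sinh_iff.2 ht
  exact (Real.tendsto_arctan_atTop.mono_right nhdsWithin_le_nhds).comp h1

lemma cosh_int : IntegrableOn (fun t => 1 / Real.cosh t) (Ioi 0) :=
  integrableOn_Ioi_deriv_of_nonneg' (fun t _ => hasDeriv_arctan_sinh t)
    (fun t _ => by have := Real.cosh_pos t; positivity) tendsto_arctan_sinh

lemma cosh_int_eq : ∫ t in Ioi (0:ℝ), 1 / Real.cosh t = π / 2 := by
  rw [integral_Ioi_of_hasDerivAt_of_nonneg' (fun t _ => hasDeriv_arctan_sinh t)
    (fun t _ => by have := Real.cosh_pos t; positivity) tendsto_arctan_sinh]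
  simp

lemma exp_abs_int_eq {a : ℝ} (ha : 0 < a) : ∫ u : ℝ, Real.exp (-a * |u|) = 2 / a := by
  rw [integral_comp_abs (f := fun x => Real.exp (-a * x)), integral_exp_mul_Ioi (by linarith)]
  simp; field_simp

lemma exp_abs_int {a : ℝ} (ha : 0 < a) : Integrable (fun u : ℝ => Real.exp (-a * |u|)) := by
  apply Integrable.of_integral_ne_zero
  rw [exp_abs_int_eq ha]
  positivity

lemma K0_integrand {x : ℝ} (hx : 0 < x) :
    IntegrableOn (fun t => Real.exp (-x * Real.cosh t)) (Ioi 0) := by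
  refine Integrable.mono' (cosh_int.const_mul (1 / x)) (by fun_prop) (ae_of_all _ fun t => ?_)
  have h := Real.cosh_pos t
  rw [Real.norm_eq_abs, Real.abs_exp, neg_mul, Real.exp_neg, one_div_mul_one_div, inv_eq_one_div]
  apply one_div_le_one_div_of_le (by positivity)
  linarith [Real.add_one_le_exp (x * Real.cosh t)]

lemma K0_nonneg (x : ℝ) : 0 ≤ K0 x := integral_nonneg fun t => (Real.exp_pos _).le

lemma K0_strict {x y : ℝ} (hx : 0 < x) (hxy : x < y) : K0 y < K0 x := by
  have hy := hx.trans hxy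
  rw [← sub_pos]
  unfold K0
  rw [← integral_sub (K0_integrand hx) (K0_integrand hy)]
  have hpos : ∀ t, 0 < Real.exp (-x * Real.cosh t) - Real.exp (-y * Real.cosh t) := by
    intro t
    have h := Real.cosh_pos t
    rw [sub_pos, Real.exp_lt_exp]
    nlinarith
  rw [integral_pos_iff_support_of_nonneg (fun t => (hpos t).le)
    ((K0_integrand hx).sub (K0_integrand hy))]
  have : Function.support (fun t => Real.exp (-x * Real.cosh t) - Real.exp (-y * Real.cosh t))
      = univ := by
    exact eq_univ_of_forall fun t => (hpos t).ne'
  rw [this]; simp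

lemma K0_anti {x y : ℝ} (hx : 0 < x) (hxy : x ≤ y) : K0 y ≤ K0 x := by
  rcases hxy.eq_or_lt with h | h
  · rw [h]
  · exact (K0_strict hx h).le

lemma K0_meas : Measurable K0 := by
  have : StronglyMeasurable (fun p : ℝ × ℝ => Real.exp (-p.1 * Real.cosh p.2)) := by
    apply Continuous.stronglyMeasurable; fun_prop
  exact (this.integral_prod_right (ν := volume.restrict (Ioi 0))).measurable

lemma K0_prod {a : ℝ} (ha : 0 < a) :
    Integrable (Function.uncurry fun u t : ℝ => Real.exp (-(a * |u|) * Real.cosh t))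
      (volume.prod (volume.restrict (Ioi 0))) := by
  have e : ∀ u t : ℝ, -(a * |u|) * Real.cosh t = -(a * Real.cosh t) * |u| := by intros; ring
  have hp : ∀ t, 0 < a * Real.cosh t := fun t => mul_pos ha (Real.cosh_pos t)
  rw [integrable_prod_iff' (by
    apply Continuous.aestronglyMeasurable
    simp only [Function.uncurry_def]; fun_prop)]
  simp only [Function.uncurry, Real.norm_eq_abs, Real.abs_exp, e]
  refine ⟨ae_of_all _ fun t => exp_abs_int (hp t), ?_⟩
  simp only [exp_abs_int_eq (hp _)]
  refine (cosh_int.const_mul (2 / a)).congr (ae_of_all _ fun t => ?_)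
  have := Real.cosh_pos t
  simp only; field_simp

lemma K0_int {a : ℝ} (ha : 0 < a) : Integrable (fun u : ℝ => K0 (a * |u|)) :=
  (K0_prod ha).integral_prod_left

lemma K0_int_eq {a : ℝ} (ha : 0 < a) : ∫ u : ℝ, K0 (a * |u|) = π / a := by
  have e : ∀ u t : ℝ, -(a * |u|) * Real.cosh t = -(a * Real.cosh t) * |u| := by intros; ring
  have hp : ∀ t, 0 < a * Real.cosh t := fun t => mul_pos ha (Real.cosh_pos t)
  unfold K0
  rw [integral_integral_swap (K0_prod ha)]
  simp only [e, exp_abs_int_eq (hp _)]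
  have : ∀ t, 2 / (a * Real.cosh t) = (2 / a) * (1 / Real.cosh t) := by
    intro t; have := Real.cosh_pos t; field_simp
  simp only [this]
  rw [integral_const_mul, cosh_int_eq]; field_simp

lemma K0_sq_int {a : ℝ} (ha : 0 < a) : Integrable (fun u : ℝ => u ^ 2 * K0 (a * |u|)) := by
  have ha2 : 0 < a / 2 := by linarith
  refine Integrable.mono' ((K0_int ha2).const_mul (8 / a ^ 2)) ?_ (ae_of_all _ fun u => ?_)
  · apply Measurable.aestronglyMeasurable
    exact (measurable_id.pow_const 2).mul (K0_meas.comp (by fun_prop))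
  · rw [Real.norm_eq_abs, abs_of_nonneg (mul_nonneg (sq_nonneg u) (K0_nonneg _))]
    rcases eq_or_ne u 0 with rfl | hu
    · simp only [ne_eq, OfNat.ofNat_ne_zero, not_false_eq_true, zero_pow, zero_mul]
      exact mul_nonneg (by positivity) (K0_nonneg _)
    have hu' : 0 < |u| := abs_pos.2 hu
    unfold K0
    rw [← integral_const_mul, ← integral_const_mul]
    refine integral_mono ((K0_integrand (by positivity)).const_mul _)
      ((K0_integrand (by positivity)).const_mul _) fun t => ?_
    have hx : 0 ≤ a / 2 * |u| * Real.cosh t := by have := Real.cosh_pos t; positivity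
    have h1 := Real.pow_div_factorial_le_exp _ hx 2
    have hc := Real.one_le_cosh t
    have h2 : u ^ 2 ≤ 8 / a ^ 2 * Real.exp (a / 2 * |u| * Real.cosh t) := by
      have h3 : (a / 2 * |u|) ^ 2 ≤ (a / 2 * |u| * Real.cosh t) ^ 2 := by
        apply pow_le_pow_left₀ (by positivity)
        exact le_mul_of_one_le_right (by positivity) hc
      rw [div_mul_eq_mul_div, le_div_iff₀ (by positivity), ← sq_abs]
      norm_num [Nat.factorial] at h1
      nlinarith
    have h4 : Real.exp (-(a / 2 * |u|) * Real.cosh t)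
        = Real.exp (a / 2 * |u| * Real.cosh t) * Real.exp (-(a * |u|) * Real.cosh t) := by
      rw [← Real.exp_add]; congr 1; ring
    simp only
    rw [h4, ← mul_assoc]
    exact mul_le_mul_of_nonneg_right h2 (Real.exp_pos _).le

/-- the Gaussian trial function -/
noncomputable def G (δ s : ℝ) : ℝ := Real.exp (-((δ * s) ^ 2 / 2))

lemma G_pos (δ s : ℝ) : 0 < G δ s := Real.exp_pos _
lemma G_le (δ s : ℝ) : G δ s ≤ 1 := by
  unfold G; rw [Real.exp_le_one_iff]; have := sq_nonneg (δ * s); linarith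
lemma G_meas (δ : ℝ) : Measurable (G δ) := by unfold G; fun_prop
lemma G_int {δ : ℝ} (hδ : 0 < δ) : Integrable (G δ) := by
  refine (integrable_exp_neg_mul_sq (b := δ ^ 2 / 2) (by positivity)).congr (ae_of_all _ fun s => ?_)
  simp only [G]; congr 1; ring

lemma G_mono {δ : ℝ} (h0 : 0 < δ) (h1 : δ ≤ 1) (s : ℝ) : G 1 s ≤ G δ s := by
  unfold G
  rw [Real.exp_le_exp]
  have : δ ^ 2 ≤ 1 := by nlinarith
  nlinarith [sq_nonneg s]

lemma G_sq_eq {δ : ℝ} (hδ : 0 < δ) : ∫ s, (G δ s) ^ 2 = √π / δ := by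
  have : ∀ s, (G δ s) ^ 2 = Real.exp (-(δ ^ 2) * s ^ 2) := by
    intro s; unfold G; rw [← Real.exp_nat_mul]; congr 1; push_cast; ring
  simp only [this]
  rw [integral_gaussian, Real.sqrt_div pi_pos.le, Real.sqrt_sq hδ.le]

lemma G_corr (δ u : ℝ) : ∫ s, G δ s * G δ (s - u) =
    Real.exp (-(δ ^ 2 * u ^ 2 / 4)) * ∫ s, (G δ s) ^ 2 := by
  have : ∀ s, G δ s * G δ (s - u) = Real.exp (-(δ ^ 2 * u ^ 2 / 4)) * (G δ (s - u / 2)) ^ 2 := by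
    intro s; unfold G; rw [← Real.exp_nat_mul, ← Real.exp_add, ← Real.exp_add]; congr 1
    push_cast; ring
  simp only [this]
  rw [integral_const_mul, integral_sub_right_eq_self (fun s => (G δ s) ^ 2)]

lemma straight {κ δ : ℝ} (hκ : 0 < κ) (hδ : 0 < δ) :
    (π / κ) * (∫ s, (G δ s) ^ 2) - δ * (√π / 4 * ∫ u, u ^ 2 * K0 (κ * |u|)) ≤
      ∫ s, ∫ s', K0 (κ * |s - s'|) * G δ s * G δ s' := by
  have h1 : ∀ s, ∫ s', K0 (κ * |s - s'|) * G δ s * G δ s' =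
      ∫ u, K0 (κ * |u|) * G δ s * G δ (s - u) := by
    intro s
    rw [← integral_sub_left_eq_self (fun u => K0 (κ * |u|) * G δ s * G δ (s - u)) volume s]
    simp
  simp only [h1]
  have hKm : Measurable fun u : ℝ => K0 (κ * |u|) := K0_meas.comp (by fun_prop)
  have hi : Integrable (Function.uncurry fun s u => K0 (κ * |u|) * G δ s * G δ (s - u))
      (volume.prod volume) := by
    refine Integrable.mono' ((G_int hδ).mul_prod (K0_int hκ)) ?_ (ae_of_all _ fun p => ?_)
    · apply Measurable.aestronglyMeasurable
      exact ((hKm.comp measurable_snd).mul ((G_meas δ).comp measurable_fst)).mul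
        ((G_meas δ).comp (measurable_fst.sub measurable_snd))
    · have a1 := K0_nonneg (κ * |p.2|)
      have a2 := G_pos δ p.1
      have a3 := G_pos δ (p.1 - p.2)
      have a4 := G_le δ (p.1 - p.2)
      simp only [Function.uncurry]
      rw [Real.norm_eq_abs, abs_of_nonneg (by positivity), mul_comm (G δ p.1)]
      exact mul_le_of_le_one_right (by positivity) a4
  rw [integral_integral_swap hi]
  simp only [mul_assoc, integral_const_mul, G_corr]
  simp only [← mul_assoc, integral_mul_const]
  rw [G_sq_eq hδ]
  have key : π / κ - δ ^ 2 / 4 * ∫ u, u ^ 2 * K0 (κ * |u|) ≤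
      ∫ u, K0 (κ * |u|) * Real.exp (-(δ ^ 2 * u ^ 2 / 4)) := by
    rw [← K0_int_eq hκ, ← integral_const_mul, ← integral_sub (K0_int hκ) ((K0_sq_int hκ).const_mul _)]
    refine integral_mono ((K0_int hκ).sub ((K0_sq_int hκ).const_mul _)) ?_ fun u => ?_
    · refine Integrable.mono' (K0_int hκ) ?_ (ae_of_all _ fun u => ?_)
      · exact (hKm.mul (by fun_prop)).aestronglyMeasurable
      · rw [Real.norm_eq_abs, abs_of_nonneg (mul_nonneg (K0_nonneg _) (Real.exp_pos _).le)]
        refine mul_le_of_le_one_right (K0_nonneg _) ?_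
        rw [Real.exp_le_one_iff]; have : 0 ≤ δ ^ 2 * u ^ 2 / 4 := by positivity
        linarith
    · have := Real.add_one_le_exp (-(δ ^ 2 * u ^ 2 / 4))
      have h := mul_le_mul_of_nonneg_left this (K0_nonneg (κ * |u|))
      simp only
      linarith
  have hs : 0 ≤ √π / δ := by positivity
  refine le_trans (le_of_eq ?_) (mul_le_mul_of_nonneg_right key hs)
  field_simp

lemma form_int {a δ : ℝ} (ha : 0 < a) (hδ : 0 < δ) :
    Integrable (fun p : ℝ × ℝ => K0 (a * |p.1 - p.2|) * G δ p.2) (volume.prod volume) := by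
  have := (G_int hδ).convolution_integrand (ContinuousLinearMap.mul ℝ ℝ) (K0_int ha)
  refine this.congr (ae_of_all _ fun p => ?_)
  simp [mul_comm]

end BS

/-- **Lemma 5.1 (variational lemma).** For a non-straight curve `γ` satisfying the arc-length
bound and (a1), there is a real-valued Schwartz function `ψ` such that the quadratic form of
the Birman–Schwinger operator `R^κ_{α,γ}` with kernel `(α/2π) K₀(κ|γ(s)−γ(s')|)` evaluated at
`ψ` exceeds `(α/2κ)‖ψ‖²`; hence `sup σ(R^κ_{α,γ}) > α/(2κ)`. -/
theorem birman_schwinger_form_exceeds_threshold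
    (α κ : ℝ) (hα : 0 < α) (hκ : 0 < κ) (γ : ℝ → Plane)
    (hLip : ∀ s s' : ℝ, ‖γ s - γ s'‖ ≤ |s - s'|)
    (c : ℝ) (hc0 : 0 < c) (hc1 : c < 1)
    (ha1 : ∀ s s' : ℝ, c * |s - s'| ≤ ‖γ s - γ s'‖)
    (hnotstraight : ∃ s s' : ℝ, ‖γ s - γ s'‖ < |s - s'|) :
    ∃ ψ : SchwartzMap ℝ ℝ,
      (α / (2 * π)) * ∫ s : ℝ, ∫ s' : ℝ, K0 (κ * ‖γ s - γ s'‖) * ψ s * ψ s'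
        > (α / (2 * κ)) * ∫ s : ℝ, (ψ s) ^ 2 := by
  have hγ : Continuous γ := by
    have : LipschitzWith 1 γ := LipschitzWith.of_dist_le_mul fun x y => by
      simpa [dist_eq_norm, Real.norm_eq_abs] using hLip x y
    exact this.continuous
  -- pointwise comparison
  have hcmp : ∀ s s', K0 (κ * |s - s'|) ≤ K0 (κ * ‖γ s - γ s'‖) := by
    intro s s'
    rcases eq_or_ne s s' with rfl | h
    · simp
    · have h' : 0 < |s - s'| := abs_pos.2 (sub_ne_zero.2 h)
      have : 0 < ‖γ s - γ s'‖ := lt_of_lt_of_le (by positivity) (ha1 s s')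
      exact BS.K0_anti (by positivity) (mul_le_mul_of_nonneg_left (hLip s s') hκ.le)
  have hcmp2 : ∀ s s', K0 (κ * ‖γ s - γ s'‖) ≤ K0 (κ * c * |s - s'|) := by
    intro s s'
    rcases eq_or_ne s s' with rfl | h
    · simp
    · have h' : 0 < |s - s'| := abs_pos.2 (sub_ne_zero.2 h)
      rw [mul_assoc]
      exact BS.K0_anti (by positivity) (mul_le_mul_of_nonneg_left (ha1 s s') hκ.le)
  have hI1 : ∀ δ, 0 < δ → Integrable
      (fun p : ℝ × ℝ => K0 (κ * ‖γ p.1 - γ p.2‖) * BS.G δ p.1 * BS.G δ p.2)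
      (volume.prod volume) := by
    intro δ hδ
    refine Integrable.mono' (BS.form_int (mul_pos hκ hc0) hδ) ?_ (ae_of_all _ fun p => ?_)
    · apply Measurable.aestronglyMeasurable
      refine Measurable.mul (Measurable.mul (BS.K0_meas.comp ?_) ((BS.G_meas δ).comp measurable_fst))
        ((BS.G_meas δ).comp measurable_snd)
      apply Continuous.measurable; fun_prop
    · have a1 := BS.K0_nonneg (κ * ‖γ p.1 - γ p.2‖)
      have a2 := BS.G_pos δ p.1
      have a3 := BS.G_pos δ p.2
      have a4 := BS.G_le δ p.1
      rw [Real.norm_eq_abs, abs_of_nonneg (by positivity)]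
      refine mul_le_mul_of_nonneg_right ?_ a3.le
      exact (mul_le_of_le_one_right a1 a4).trans (hcmp2 _ _)
  have hI2 : ∀ δ, 0 < δ → Integrable
      (fun p : ℝ × ℝ => K0 (κ * |p.1 - p.2|) * BS.G δ p.1 * BS.G δ p.2)
      (volume.prod volume) := by
    intro δ hδ
    refine Integrable.mono' (BS.form_int hκ hδ) ?_ (ae_of_all _ fun p => ?_)
    · apply Measurable.aestronglyMeasurable
      refine Measurable.mul (Measurable.mul (BS.K0_meas.comp ?_) ((BS.G_meas δ).comp measurable_fst))
        ((BS.G_meas δ).comp measurable_snd)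
      apply Continuous.measurable; fun_prop
    · have a1 := BS.K0_nonneg (κ * |p.1 - p.2|)
      have a2 := BS.G_pos δ p.1
      have a3 := BS.G_pos δ p.2
      have a4 := BS.G_le δ p.1
      rw [Real.norm_eq_abs, abs_of_nonneg (by positivity)]
      refine mul_le_mul_of_nonneg_right ?_ a3.le
      exact mul_le_of_le_one_right a1 a4
  set D : ℝ → ℝ := fun δ => ∫ p : ℝ × ℝ, (K0 (κ * ‖γ p.1 - γ p.2‖) * BS.G δ p.1 * BS.G δ p.2
    - K0 (κ * |p.1 - p.2|) * BS.G δ p.1 * BS.G δ p.2) ∂(volume.prod volume) with hD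
  have hDpos : 0 < D 1 := by
    rw [hD]
    simp only
    refine (integral_pos_iff_support_of_nonneg ?_ ((hI1 1 one_pos).sub (hI2 1 one_pos))).2 ?_
    rotate_left
    · obtain ⟨s, s', hs⟩ := hnotstraight
      have hop : IsOpen {p : ℝ × ℝ | ‖γ p.1 - γ p.2‖ < |p.1 - p.2|} :=
        isOpen_lt (by fun_prop) (by fun_prop)
      refine lt_of_lt_of_le (hop.measure_pos (volume.prod volume) ⟨(s, s'), hs⟩) (measure_mono ?_)
      intro p hp
      have hp' : ‖γ p.1 - γ p.2‖ < |p.1 - p.2| := hp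
      have h0 : 0 < |p.1 - p.2| := (norm_nonneg _).trans_lt hp'
      have h1 : 0 < ‖γ p.1 - γ p.2‖ := lt_of_lt_of_le (by positivity) (ha1 p.1 p.2)
      have h2 := BS.K0_strict (mul_pos hκ h1) (mul_lt_mul_of_pos_left hp' hκ)
      have a2 := BS.G_pos 1 p.1
      have a3 := BS.G_pos 1 p.2
      rw [Function.mem_support]
      apply ne_of_gt
      rw [Pi.sub_apply, sub_pos]
      gcongr
    · intro p
      have a2 := BS.G_pos 1 p.1
      have a3 := BS.G_pos 1 p.2
      have := hcmp p.1 p.2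
      simp only [Pi.zero_apply, Pi.sub_apply, sub_nonneg]
      gcongr
  have hDmono : ∀ δ, 0 < δ → δ ≤ 1 → D 1 ≤ D δ := by
    intro δ h0 h1
    refine integral_mono ((hI1 1 one_pos).sub (hI2 1 one_pos)) ((hI1 δ h0).sub (hI2 δ h0)) fun p => ?_
    have a2 := BS.G_pos 1 p.1
    have a3 := BS.G_pos 1 p.2
    have a4 := BS.G_mono h0 h1 p.1
    have a5 := BS.G_mono h0 h1 p.2
    have := sub_nonneg.2 (hcmp p.1 p.2)
    simp only [← sub_mul]
    gcongr
    exact mul_nonneg this (BS.G_pos δ p.1).le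
  set M : ℝ := √π / 4 * ∫ u, u ^ 2 * K0 (κ * |u|) with hM
  have hM0 : 0 ≤ M := mul_nonneg (by positivity)
    (integral_nonneg fun u => mul_nonneg (sq_nonneg u) (BS.K0_nonneg _))
  obtain ⟨δ, hδ0, hδ1, hδM⟩ : ∃ δ : ℝ, 0 < δ ∧ δ ≤ 1 ∧ δ * M < D 1 := by
    refine ⟨min 1 (D 1 / (M + 1)), by positivity, min_le_left _ _, ?_⟩
    calc min 1 (D 1 / (M + 1)) * M ≤ D 1 / (M + 1) * M := by gcongr; exact min_le_right _ _
      _ < D 1 := by rw [div_mul_eq_mul_div, div_lt_iff₀ (by positivity)]; nlinarith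
  obtain ⟨ψ, hψ⟩ := BS.exists_schwartz δ hδ0
  refine ⟨ψ, ?_⟩
  have hψ' : ∀ s, ψ s = BS.G δ s := hψ
  simp only [hψ']
  have hst := BS.straight hκ hδ0
  rw [← hM] at hst
  have hDd := hDmono δ hδ0 hδ1
  have hsplit : D δ = (∫ s, ∫ s', K0 (κ * ‖γ s - γ s'‖) * BS.G δ s * BS.G δ s')
      - ∫ s, ∫ s', K0 (κ * |s - s'|) * BS.G δ s * BS.G δ s' := by
    rw [hD]
    simp only
    rw [integral_sub (hI1 δ hδ0) (hI2 δ hδ0), integral_prod _ (hI1 δ hδ0),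
      integral_prod _ (hI2 δ hδ0)]
  have hfin : (π / κ) * (∫ s, (BS.G δ s) ^ 2) <
      ∫ s, ∫ s', K0 (κ * ‖γ s - γ s'‖) * BS.G δ s * BS.G δ s' := by linarith
  have : α / (2 * κ) * (∫ s, (BS.G δ s) ^ 2) =
      α / (2 * π) * ((π / κ) * ∫ s, (BS.G δ s) ^ 2) := by
    field_simp
  rw [gt_iff_lt, this]
  exact mul_lt_mul_of_pos_left hfin (by positivity)
end

section
/- Let α, κ > 0. The bounded linear operator R^κ_{α,γ₀} on L²(ℝ) given by convolution with the integrable function s ↦ (α/(2π)) K₀(κ |s|), i.e. (R^κ_{α,γ₀} ψ)(s) = (α/(2π)) ∫_ℝ K₀(κ |s − s'|) ψ(s') ds', is unitarily equivalent under the Fourier transform to multiplication by p ↦ (α/2)(p² + κ²)^{−1/2}, and its spectrum equals the interval [0, α/(2κ)]. -/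
open MeasureTheory Real Complex

open scoped FourierTransform SchwartzMap in
lemma aux_fourier_L2 (ψ : Lp ℂ 2 (volume : Measure ℝ)) (h : Integrable (ψ : ℝ → ℂ)) :
    (Lp.fourierTransformₗᵢ ℝ ℂ ψ : ℝ → ℂ) =ᵐ[volume] 𝓕 (ψ : ℝ → ℂ) := by
  have hc : Continuous (𝓕 (ψ : ℝ → ℂ)) :=
    VectorFourier.fourierIntegral_continuous Real.continuous_fourierChar
      (by exact continuous_inner) h
  apply ae_eq_of_integral_contDiff_smul_eq
  · exact (Lp.memLp _).locallyIntegrable (by norm_num)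
  · exact hc.locallyIntegrable
  intro g g_smooth g_cpt
  have hg₁ : HasCompactSupport (Complex.ofRealCLM ∘ g) := g_cpt.comp_left rfl
  have hg₂ : ContDiff ℝ (⊤ : ℕ∞) (Complex.ofRealCLM ∘ g) := by fun_prop
  have key := Lp.fourier_toTemperedDistribution_eq ψ
  have key2 := congrArg (fun F => F (hg₁.toSchwartzMap hg₂)) key
  simp only [TemperedDistribution.fourier_apply, Lp.toTemperedDistribution_apply] at key2
  have e1 : ∫ x, g x • (Lp.fourierTransformₗᵢ ℝ ℂ ψ : ℝ → ℂ) x =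
    ∫ x, (hg₁.toSchwartzMap hg₂) x • ((𝓕 ψ : Lp ℂ 2 (volume : Measure ℝ)) : ℝ → ℂ) x := by
    simp; rfl
  rw [e1, ← key2]
  have sw := VectorFourier.integral_fourierIntegral_smul_eq_flip (L := innerₗ ℝ) (μ := volume) (ν := volume)
      Real.continuous_fourierChar continuous_inner (hg₁.toSchwartzMap hg₂).integrable h
  rw [flip_innerₗ] at sw
  refine Eq.trans ?_ (sw.trans ?_)
  · rw [SchwartzMap.fourier_coe]; rfl
  · simp; rfl

open scoped FourierTransform SchwartzMap in
lemma aux_fourierInv_L2 (ψ : Lp ℂ 2 (volume : Measure ℝ)) (h : Integrable (ψ : ℝ → ℂ)) :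
    ((Lp.fourierTransformₗᵢ ℝ ℂ).symm ψ : ℝ → ℂ) =ᵐ[volume] 𝓕⁻ (ψ : ℝ → ℂ) := by
  have hc : Continuous (𝓕⁻ (ψ : ℝ → ℂ)) :=
    VectorFourier.fourierIntegral_continuous (L := -innerₗ ℝ) Real.continuous_fourierChar
      (by simpa using! continuous_inner.neg) h
  apply ae_eq_of_integral_contDiff_smul_eq
  · exact (Lp.memLp _).locallyIntegrable (by norm_num)
  · exact hc.locallyIntegrable
  intro g g_smooth g_cpt
  have hg₁ : HasCompactSupport (Complex.ofRealCLM ∘ g) := g_cpt.comp_left rfl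
  have hg₂ : ContDiff ℝ (⊤ : ℕ∞) (Complex.ofRealCLM ∘ g) := by fun_prop
  have key := Lp.fourierInv_toTemperedDistribution_eq ψ
  have key2 := congrArg (fun F => F (hg₁.toSchwartzMap hg₂)) key
  simp only [TemperedDistribution.fourierInv_apply, Lp.toTemperedDistribution_apply] at key2
  have e1 : ∫ x, g x • ((Lp.fourierTransformₗᵢ ℝ ℂ).symm ψ : ℝ → ℂ) x =
    ∫ x, (hg₁.toSchwartzMap hg₂) x • ((𝓕⁻ ψ : Lp ℂ 2 (volume : Measure ℝ)) : ℝ → ℂ) x := by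
    simp; rfl
  rw [e1, ← key2]
  have sw := VectorFourier.integral_fourierIntegral_smul_eq_flip (L := -innerₗ ℝ) (μ := volume) (ν := volume)
      Real.continuous_fourierChar (by simpa using! continuous_inner.neg) (hg₁.toSchwartzMap hg₂).integrable h
  have hf : (-innerₗ ℝ).flip = -innerₗ ℝ := by
    ext; simp
  rw [hf] at sw
  refine Eq.trans ?_ (sw.trans ?_)
  · rw [SchwartzMap.fourierInv_coe]; rfl
  · simp; rfl

lemma aux_mul (m : ℝ → ℂ) (hm : Measurable m) (C : ℝ) (hC : ∀ x, ‖m x‖ ≤ C) :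
    ∃ M : Lp ℂ 2 (volume : Measure ℝ) →L[ℂ] Lp ℂ 2 (volume : Measure ℝ),
      ∀ f, (M f : ℝ → ℂ) =ᵐ[volume] fun x => m x * f x := by
  have hmem : MemLp m ⊤ (volume : Measure ℝ) :=
    memLp_top_of_bound hm.aestronglyMeasurable C (Filter.Eventually.of_forall hC)
  refine ⟨(ContinuousLinearMap.mul ℂ ℂ).holderL volume ⊤ 2 2 (hmem.toLp m), fun f => ?_⟩
  have h1 := (ContinuousLinearMap.mul ℂ ℂ).coeFn_holder (r := 2) (hmem.toLp m) f
  filter_upwards [h1, hmem.coeFn_toLp] with x h1 h2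
  exact h1.trans (by simp [h2])

lemma aux_norm_sq (f : Lp ℂ 2 (volume : Measure ℝ)) : ‖f‖ ^ 2 = ∫ x, ‖f x‖ ^ 2 := by
  have h := L2.inner_def (𝕜 := ℂ) f f
  rw [inner_self_eq_norm_sq_to_K] at h
  simp only [inner_self_eq_norm_sq_to_K] at h
  have h2 : ∫ a, ((‖f a‖ : ℂ)) ^ 2 = ((∫ a, ‖f a‖ ^ 2 : ℝ) : ℂ) := by
    rw [← integral_complex_ofReal]; push_cast; rfl
  have h3 : ((‖f‖ ^ 2 : ℝ) : ℂ) = ((∫ a, ‖f a‖ ^ 2 : ℝ) : ℂ) := by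
    rw [← h2]; push_cast; exact h
  exact_mod_cast h3

lemma aux_qmp (a : ℝ) (ha : 0 < a) :
    Measure.QuasiMeasurePreserving (fun x : ℝ => a * x) volume volume := by
  refine ⟨measurable_const_mul a, ?_⟩
  rw [Real.map_volume_mul_left ha.ne']
  exact Measure.smul_absolutelyContinuous

lemma aux_memLp_dil (a : ℝ) (ha : 0 < a) (f : Lp ℂ 2 (volume : Measure ℝ)) :
    MemLp (fun x => ((√a : ℝ) : ℂ) * f (a * x)) 2 (volume : Measure ℝ) := by
  have h := Lp.memLp f
  have hs : AEStronglyMeasurable (fun x => f (a * x)) (volume : Measure ℝ) :=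
    (Lp.aestronglyMeasurable f).comp_quasiMeasurePreserving (aux_qmp a ha)
  have : MemLp (fun x => f (a * x)) 2 (volume : Measure ℝ) := by
    rw [memLp_two_iff_integrable_sq_norm hs]
    exact ((memLp_two_iff_integrable_sq_norm h.1).1 h).comp_mul_left' ha.ne'
  exact this.const_mul _

lemma aux_dil_lin (a : ℝ) (ha : 0 < a) :
    ∃ D : Lp ℂ 2 (volume : Measure ℝ) →ₗᵢ[ℂ] Lp ℂ 2 (volume : Measure ℝ),
      ∀ f, (D f : ℝ → ℂ) =ᵐ[volume] fun x => ((√a : ℝ) : ℂ) * f (a * x) := by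
  refine ⟨⟨⟨⟨fun f => (aux_memLp_dil a ha f).toLp _, ?_⟩, ?_⟩, ?_⟩, fun f => (aux_memLp_dil a ha f).coeFn_toLp⟩
  · intro f g
    apply Lp.ext
    filter_upwards [(aux_memLp_dil a ha (f+g)).coeFn_toLp, (aux_memLp_dil a ha f).coeFn_toLp,
      (aux_memLp_dil a ha g).coeFn_toLp, (aux_qmp a ha).ae (Lp.coeFn_add f g), 
      Lp.coeFn_add ((aux_memLp_dil a ha f).toLp _) ((aux_memLp_dil a ha g).toLp _)] with x h1 h2 h3 h4 h5
    rw [h1, h5, Pi.add_apply, h2, h3, h4, Pi.add_apply]; ring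
  · intro c f
    apply Lp.ext
    filter_upwards [(aux_memLp_dil a ha (c • f)).coeFn_toLp, (aux_memLp_dil a ha f).coeFn_toLp,
      (aux_qmp a ha).ae (Lp.coeFn_smul c f), 
      Lp.coeFn_smul c ((aux_memLp_dil a ha f).toLp _)] with x h1 h2 h4 h5
    simp only [RingHom.id_apply]
    rw [h1, h5, Pi.smul_apply, h2, h4, Pi.smul_apply, smul_eq_mul, smul_eq_mul]; ring
  · intro f
    change ‖(aux_memLp_dil a ha f).toLp _‖ = ‖f‖
    rw [← sq_eq_sq₀ (norm_nonneg _) (norm_nonneg _), aux_norm_sq, aux_norm_sq]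
    rw [integral_congr_ae (g := fun x => a * ‖f (a * x)‖ ^ 2)]
    · rw [integral_const_mul, Measure.integral_comp_mul_left (fun x => ‖f x‖ ^ 2) a, abs_of_pos (by positivity)]
      simp [ha.ne']
    · filter_upwards [(aux_memLp_dil a ha f).coeFn_toLp] with x h1
      rw [h1, norm_mul, mul_pow]
      simp [Real.sq_sqrt ha.le]

lemma aux_dil (a : ℝ) (ha : 0 < a) :
    ∃ D : Lp ℂ 2 (volume : Measure ℝ) ≃ₗᵢ[ℂ] Lp ℂ 2 (volume : Measure ℝ),
      ∀ f, (D f : ℝ → ℂ) =ᵐ[volume] fun x => ((√a : ℝ) : ℂ) * f (a * x) := by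
  obtain ⟨D, hD⟩ := aux_dil_lin a ha
  obtain ⟨E, hE⟩ := aux_dil_lin a⁻¹ (inv_pos.2 ha)
  refine ⟨LinearIsometryEquiv.ofSurjective D fun f => ⟨E f, ?_⟩, fun f => hD f⟩
  apply Lp.ext
  filter_upwards [hD (E f), (aux_qmp a ha).ae (hE f)] with x h1 h2
  rw [h1, h2, ← mul_assoc, ← mul_assoc, inv_mul_cancel₀ ha.ne', one_mul, ← Complex.ofReal_mul, ← Real.sqrt_mul ha.le,
    mul_inv_cancel₀ ha.ne']
  simp

lemma aux_spec (m : ℝ → ℂ) (hm : Continuous m) 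
    (M : Lp ℂ 2 (volume : Measure ℝ) →L[ℂ] Lp ℂ 2 (volume : Measure ℝ))
    (hM : ∀ f, (M f : ℝ → ℂ) =ᵐ[volume] fun x => m x * f x) :
    spectrum ℂ M = closure (Set.range m) := by
  apply Set.Subset.antisymm
  · intro z hz
    by_contra hn
    obtain ⟨ε, hε, hb⟩ : ∃ ε > 0, ∀ x, ε ≤ ‖z - m x‖ := by
      rw [Metric.mem_closure_iff] at hn
      push Not at hn
      obtain ⟨ε, hε, h⟩ := hn
      exact ⟨ε, hε, fun x => by simpa [dist_eq_norm] using h (m x) ⟨x, rfl⟩⟩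
    have hne : ∀ x, z - m x ≠ 0 := fun x h0 => by
      have := hb x; rw [h0, norm_zero] at this; linarith
    obtain ⟨R, hR⟩ := aux_mul (fun x => (z - m x)⁻¹) (by fun_prop) ε⁻¹ (fun x => by
      rw [norm_inv]; exact inv_anti₀ hε (hb x))
    have hS : ∀ f, (((algebraMap ℂ (Lp ℂ 2 (volume : Measure ℝ) →L[ℂ] Lp ℂ 2 (volume : Measure ℝ)) z - M) f : Lp ℂ 2 (volume : Measure ℝ)) : ℝ → ℂ)
        =ᵐ[volume] fun x => (z - m x) * f x := by
      intro f
      have : (algebraMap ℂ (Lp ℂ 2 (volume : Measure ℝ) →L[ℂ] Lp ℂ 2 (volume : Measure ℝ)) z - M) f = z • f - M f := by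
        simp [Algebra.algebraMap_eq_smul_one]
      rw [this]
      filter_upwards [hM f, Lp.coeFn_smul z f, Lp.coeFn_sub (z • f) (M f)] with x h1 h2 h3
      rw [h3, Pi.sub_apply, h1, h2, Pi.smul_apply, smul_eq_mul]; ring
    apply hz
    refine ⟨⟨_, R, ?_, ?_⟩, rfl⟩
    · ext1 f
      apply Lp.ext
      filter_upwards [hS (R f), hR f] with x h1 h2
      change ((algebraMap ℂ (Lp ℂ 2 (volume : Measure ℝ) →L[ℂ] Lp ℂ 2 (volume : Measure ℝ)) z - M) (R f) : Lp ℂ 2 (volume : Measure ℝ)) x = f x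
      rw [h1, h2, ← mul_assoc, mul_inv_cancel₀ (hne x), one_mul]
    · ext1 f
      apply Lp.ext
      filter_upwards [hR ((algebraMap ℂ (Lp ℂ 2 (volume : Measure ℝ) →L[ℂ] Lp ℂ 2 (volume : Measure ℝ)) z - M) f), hS f] with x h1 h2
      change (R ((algebraMap ℂ (Lp ℂ 2 (volume : Measure ℝ) →L[ℂ] Lp ℂ 2 (volume : Measure ℝ)) z - M) f) : Lp ℂ 2 (volume : Measure ℝ)) x = f x
      rw [h1, h2, ← mul_assoc, inv_mul_cancel₀ (hne x), one_mul]
  · apply closure_minimal _ (spectrum.isClosed M)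
    rintro _ ⟨p, rfl⟩
    intro hu
    obtain ⟨⟨S, R, hSR, hRS⟩, hSeq⟩ := hu
    simp only at hSeq
    obtain ⟨δ, hδ, hδm⟩ := Metric.continuous_iff.1 hm p (1 / (2 * (‖R‖ + 1))) (by positivity)
    let B := Metric.ball p δ
    have hBfin : volume B ≠ ⊤ := measure_ball_lt_top.ne
    let f : Lp ℂ 2 (volume : Measure ℝ) := indicatorConstLp 2 (Metric.isOpen_ball.measurableSet : MeasurableSet B) hBfin 1
    have hf0 : f ≠ 0 := by
      intro h0
      have : ‖f‖ = 0 := by rw [h0, norm_zero]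
      rw [norm_indicatorConstLp (by norm_num) (by norm_num)] at this
      have hpos : 0 < volume.real B := by
        rw [measureReal_def]
        exact ENNReal.toReal_pos (Metric.measure_ball_pos volume p hδ).ne' hBfin
      have h3 := Real.rpow_pos_of_pos hpos (1 / (2 : ENNReal).toReal)
      rw [norm_one, one_mul] at this
      exact h3.ne' this
    have hS : ‖S f‖ ≤ 1 / (2 * (‖R‖ + 1)) * ‖f‖ := by
      apply Lp.norm_le_mul_norm_of_ae_le_mul
      rw [hSeq]
      have : (algebraMap ℂ (Lp ℂ 2 (volume : Measure ℝ) →L[ℂ] Lp ℂ 2 (volume : Measure ℝ)) (m p) - M) f = (m p) • f - M f := by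
        simp [Algebra.algebraMap_eq_smul_one]
      rw [this]
      filter_upwards [hM f, Lp.coeFn_smul (m p) f, Lp.coeFn_sub ((m p) • f) (M f), indicatorConstLp_coeFn (p := 2) (hs := (Metric.isOpen_ball.measurableSet : MeasurableSet B)) (hμs := hBfin) (c := (1:ℂ))] with x h1 h2 h3 h4
      rw [h3, Pi.sub_apply, h1, h2, Pi.smul_apply, smul_eq_mul, ← sub_mul, norm_mul]
      by_cases hx : x ∈ B
      · gcongr
        have := hδm x hx
        rw [dist_comm, dist_eq_norm] at this
        exact this.le
      · have : f x = 0 := by rw [h4]; exact Set.indicator_of_notMem hx _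
        simp [this]
    have hRSf : R (S f) = f := congrArg (fun A => A f) hRS
    have h1 : ‖f‖ ≤ ‖R‖ * (1 / (2 * (‖R‖ + 1)) * ‖f‖) := by
      calc ‖f‖ = ‖R (S f)‖ := by rw [hRSf]
        _ ≤ ‖R‖ * ‖S f‖ := R.le_opNorm _
        _ ≤ _ := by gcongr
    have h2 : ‖R‖ * (1 / (2 * (‖R‖ + 1))) < 1 := by
      rw [mul_one_div, div_lt_one (by positivity)]
      nlinarith [norm_nonneg R]
    have h3 : 0 < ‖f‖ := norm_pos_iff.2 hf0
    nlinarith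

lemma aux_ft_exp (w p : ℝ) (hw : 0 < w) :
    Integrable (fun s : ℝ => Complex.exp (-Complex.I * p * s) * Complex.exp (-(w * |s| : ℝ))) ∧
    ∫ s : ℝ, Complex.exp (-Complex.I * p * s) * Complex.exp (-(w * |s| : ℝ))
      = (2 * w / (w ^ 2 + p ^ 2) : ℝ) := by
  have e1 : Set.EqOn (fun s : ℝ => Complex.exp (-Complex.I * p * s) * Complex.exp (-(w * |s| : ℝ)))
      (fun s : ℝ => Complex.exp ((-w - Complex.I * p) * s)) (Set.Ioi 0) := by
    intro s hs
    simp only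
    rw [abs_of_pos hs, ← Complex.exp_add]; push_cast; ring_nf
  have e2 : Set.EqOn (fun s : ℝ => Complex.exp (-Complex.I * p * s) * Complex.exp (-(w * |s| : ℝ)))
      (fun s : ℝ => Complex.exp ((w - Complex.I * p) * s)) (Set.Iic 0) := by
    intro s hs
    simp only
    rw [abs_of_nonpos hs, ← Complex.exp_add]; push_cast; ring_nf
  have r1 : (-w - Complex.I * p : ℂ).re < 0 := by simp [hw]
  have r2 : 0 < (w - Complex.I * p : ℂ).re := by simp [hw]
  have i1 := (integrableOn_congr_fun e1 measurableSet_Ioi).2 (integrableOn_exp_mul_complex_Ioi r1 0)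
  have i2 := (integrableOn_congr_fun e2 measurableSet_Iic).2 (integrableOn_exp_mul_complex_Iic r2 0)
  have n1 : (-w - Complex.I * p : ℂ) ≠ 0 := fun h => by rw [h] at r1; simp at r1
  have n2 : (w - Complex.I * p : ℂ) ≠ 0 := fun h => by rw [h] at r2; simp at r2
  constructor
  · rw [← integrableOn_univ, ← Set.Iic_union_Ioi (a := (0:ℝ))]
    exact i2.union i1
  · rw [← intervalIntegral.integral_Iic_add_Ioi i2 i1, setIntegral_congr_fun measurableSet_Iic e2,
      setIntegral_congr_fun measurableSet_Ioi e1, integral_exp_mul_complex_Ioi r1,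
      integral_exp_mul_complex_Iic r2]
    have n3 : (w ^ 2 + p ^ 2 : ℂ) ≠ 0 := by
      have : w ^ 2 + p ^ 2 ≠ 0 := by positivity
      exact_mod_cast this
    push_cast
    simp only [mul_zero, Complex.exp_zero]
    field_simp
    ring_nf
    simp only [Complex.I_sq]
    ring

lemma aux_prod {Ω : Type*} [MeasurableSpace Ω] (μ : Measure Ω) [SFinite μ] (w : Ω → ℝ)
    (hw : ∀ x, 0 < w x) (hwm : Measurable w) (hi : Integrable (fun x => (w x)⁻¹) μ) :
    Integrable (fun z : ℝ × Ω => Real.exp (-(w z.2 * |z.1|))) ((volume : Measure ℝ).prod μ) := by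
  have key : ∀ x, Integrable (fun s : ℝ => Real.exp (-(w x * |s|))) ∧
      ∫ s : ℝ, Real.exp (-(w x * |s|)) = 2 * (w x)⁻¹ := by
    intro x
    obtain ⟨h1, h2⟩ := aux_ft_exp (w x) 0 (hw x)
    simp only [Complex.ofReal_zero, mul_zero, zero_mul, Complex.exp_zero, one_mul, ← Complex.ofReal_neg,
      ← Complex.ofReal_exp] at h1 h2
    rw [integral_complex_ofReal] at h2
    refine ⟨h1.re, ?_⟩
    have h3 := Complex.ofReal_injective h2
    rw [h3]
    have := (hw x).ne'
    field_simp
    simp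
  rw [integrable_prod_iff' (by fun_prop)]
  refine ⟨Filter.Eventually.of_forall fun x => (key x).1, ?_⟩
  simp only [Real.norm_eq_abs, Real.abs_exp, (key _).2]
  exact hi.const_mul 2

lemma aux_exp_int (c : ℝ) (hc : 0 < c) :
    Integrable (fun t : ℝ => Real.exp (-c * t)) (volume.restrict (Set.Ioi (0:ℝ))) :=
  integrableOn_exp_mul_Ioi (by linarith) 0

lemma aux_int1 (κ : ℝ) (hκ : 0 < κ) :
    Integrable (fun z : ℝ × ℝ => Real.exp (-(κ * Real.cosh z.2 * |z.1|)))
      ((volume : Measure ℝ).prod (volume.restrict (Set.Ioi (0:ℝ)))) := by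
  apply aux_prod (volume.restrict (Set.Ioi (0:ℝ))) (fun t => κ * Real.cosh t)
    (fun t => mul_pos hκ (Real.cosh_pos t)) (by fun_prop)
  refine ((aux_exp_int 1 one_pos).const_mul (2 / κ)).mono' (by fun_prop) (Filter.Eventually.of_forall fun t => ?_)
  have h1 := Real.cosh_pos t
  rw [Real.norm_eq_abs, abs_of_pos (by positivity), Real.cosh_eq, neg_one_mul, Real.exp_neg]
  have := Real.exp_pos t
  rw [← div_eq_mul_inv, div_div, inv_eq_one_div, div_le_div_iff₀ (by positivity) (by positivity)]
  have : 0 < (Real.exp t)⁻¹ := by positivity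
  nlinarith

lemma aux_int2 (κ : ℝ) (hκ : 0 < κ) :
    Integrable (fun z : ℝ × (ℝ × ℝ) => Real.exp (-(κ * (Real.cosh z.2.1 + Real.cosh z.2.2) * |z.1|)))
      ((volume : Measure ℝ).prod ((volume.restrict (Set.Ioi (0:ℝ))).prod (volume.restrict (Set.Ioi (0:ℝ))))) := by
  apply aux_prod ((volume.restrict (Set.Ioi (0:ℝ))).prod (volume.restrict (Set.Ioi (0:ℝ))))
    (fun t : ℝ × ℝ => κ * (Real.cosh t.1 + Real.cosh t.2))
    (fun t => mul_pos hκ (add_pos (Real.cosh_pos _) (Real.cosh_pos _))) (by fun_prop)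
  have h0 : (0:ℝ) < 1 / 2 := by norm_num
  refine (((aux_exp_int (1/2) h0).mul_prod (aux_exp_int (1/2) h0)).const_mul κ⁻¹).mono' (by fun_prop)
    (Filter.Eventually.of_forall fun ⟨t, u⟩ => ?_)
  have h1 := Real.cosh_pos t
  have h2 := Real.cosh_pos u
  simp only
  rw [Real.norm_eq_abs, abs_of_pos (by positivity), mul_inv]
  gcongr
  rw [← Real.exp_add, inv_le_comm₀ (by positivity) (by positivity), ← Real.exp_neg, Real.cosh_eq, Real.cosh_eq]
  have e : Real.exp (-(-(1/2) * t + -(1/2) * u)) = Real.exp (t/2) * Real.exp (u/2) := by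
    rw [← Real.exp_add]; congr 1; ring
  have et : Real.exp t = Real.exp (t/2) ^ 2 := by rw [← Real.exp_nat_mul]; congr 1; push_cast; ring
  have eu : Real.exp u = Real.exp (u/2) ^ 2 := by rw [← Real.exp_nat_mul]; congr 1; push_cast; ring
  rw [e, et, eu]
  have := Real.exp_pos (-t)
  have := Real.exp_pos (-u)
  nlinarith [sq_nonneg (Real.exp (t/2) - Real.exp (u/2))]

lemma aux_K0_eq (κ s : ℝ) : K0 (κ * |s|) = ∫ t in Set.Ioi (0:ℝ), Real.exp (-(κ * Real.cosh t * |s|)) := by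
  unfold K0
  congr 1; ext t; congr 1; ring

lemma aux_K0_int (κ : ℝ) (hκ : 0 < κ) : Integrable (fun s : ℝ => K0 (κ * |s|)) := by
  simp only [aux_K0_eq]
  exact (aux_int1 κ hκ).integral_prod_left

lemma aux_K0_sq (κ : ℝ) (hκ : 0 < κ) : Integrable (fun s : ℝ => K0 (κ * |s|) ^ 2) := by
  convert (aux_int2 κ hκ).integral_prod_left using 1
  ext s
  rw [aux_K0_eq, sq, ← integral_prod_mul]
  congr 1; ext z
  rw [← Real.exp_add]; congr 1; ring

lemma aux_arctan (κ p : ℝ) (hκ : 0 < κ) :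
    ∫ t in Set.Ioi (0:ℝ), 2 * (κ * Real.cosh t) / ((κ * Real.cosh t) ^ 2 + p ^ 2) = π * (p ^ 2 + κ ^ 2) ^ (-(1 / 2) : ℝ) := by
  have hq0 : 0 < p ^ 2 + κ ^ 2 := by positivity
  rw [Real.rpow_neg hq0.le, ← Real.sqrt_eq_rpow]
  set q := √(p ^ 2 + κ ^ 2) with hq
  have hqp : 0 < q := Real.sqrt_pos.2 hq0
  have hq2 : q ^ 2 = p ^ 2 + κ ^ 2 := Real.sq_sqrt hq0.le
  have hd : ∀ t : ℝ, HasDerivAt (fun t => 2 / q * Real.arctan (κ / q * Real.sinh t))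
      (2 * (κ * Real.cosh t) / ((κ * Real.cosh t) ^ 2 + p ^ 2)) t := by
    intro t
    convert! (((Real.hasDerivAt_sinh t).const_mul (κ / q)).arctan).const_mul (2 / q) using 1
    have h := Real.cosh_sq t
    have hc := Real.cosh_pos t
    have e : (κ * Real.cosh t) ^ 2 + p ^ 2 = q ^ 2 + κ ^ 2 * Real.sinh t ^ 2 := by
      rw [hq2, mul_pow, h]; ring
    rw [e]
    field_simp
  have hl : Filter.Tendsto (fun t => 2 / q * Real.arctan (κ / q * Real.sinh t)) Filter.atTop (nhds (2 / q * (π / 2))) := by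
    apply Filter.Tendsto.const_mul
    apply (tendsto_nhds_of_tendsto_nhdsWithin tendsto_arctan_atTop).comp
    apply Filter.Tendsto.const_mul_atTop (by positivity)
    refine Filter.tendsto_atTop_mono' _ ?_ Filter.tendsto_id
    filter_upwards [Filter.eventually_ge_atTop 0] with t ht
    exact Real.self_le_sinh_iff.2 ht
  rw [integral_Ioi_of_hasDerivAt_of_nonneg' (fun t _ => hd t) _ hl]
  · simp; field_simp
  · intro t _
    have hc := Real.cosh_pos t
    positivity

lemma aux_K0_ft (κ p : ℝ) (hκ : 0 < κ) :
    ∫ s : ℝ, Complex.exp (-Complex.I * p * s) * (K0 (κ * |s|) : ℂ)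
      = (π * (p ^ 2 + κ ^ 2) ^ (-(1 / 2) : ℝ) : ℝ) := by
  rw [← aux_arctan κ p hκ, ← integral_complex_ofReal]
  have h1 : ∀ s : ℝ, Complex.exp (-Complex.I * p * s) * (K0 (κ * |s|) : ℂ) =
      ∫ t in Set.Ioi (0:ℝ), Complex.exp (-Complex.I * p * s) * Complex.exp (-(κ * Real.cosh t * |s| : ℝ)) := by
    intro s
    rw [aux_K0_eq, ← integral_complex_ofReal, integral_const_mul]
    simp
  simp only [h1]
  rw [integral_integral_swap]
  · congr 1; ext t
    exact (aux_ft_exp (κ * Real.cosh t) p (mul_pos hκ (Real.cosh_pos t))).2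
  · refine (aux_int1 κ hκ).mono (by apply Continuous.aestronglyMeasurable; simp only [Function.uncurry_def]; fun_prop)
      (Filter.Eventually.of_forall fun ⟨s, t⟩ => ?_)
    simp [Function.uncurry, Complex.norm_exp]

lemma aux_conv (α κ : ℝ) (hκ : 0 < κ) (m : ℝ → ℝ)
    (hmdef : ∀ ξ, m ξ = (α / 2) * ((2 * π * ξ) ^ 2 + κ ^ 2) ^ (-(1 / 2) : ℝ))
    (hm2 : MemLp (fun ξ => (m ξ : ℂ)) 2 (volume : Measure ℝ))
    (M : Lp ℂ 2 (volume : Measure ℝ) →L[ℂ] Lp ℂ 2 (volume : Measure ℝ))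
    (hM : ∀ f, (M f : ℝ → ℂ) =ᵐ[volume] fun x => (m x : ℂ) * f x)
    (ψ : Lp ℂ 2 (volume : Measure ℝ)) :
    ∀ᵐ s : ℝ, ((Lp.fourierTransformₗᵢ ℝ ℂ).symm (M (Lp.fourierTransformₗᵢ ℝ ℂ ψ)) : ℝ → ℂ) s
          = (α / (2 * π) : ℝ) * ∫ s' : ℝ, (K0 (κ * |s - s'|) : ℂ) * ψ s' := by
  set φ := Lp.fourierTransformₗᵢ ℝ ℂ ψ with hφ
  have hint : Integrable (M φ : ℝ → ℂ) := by
    have h := hm2.integrable_mul (Lp.memLp φ)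
    exact h.congr (hM φ).symm
  filter_upwards [aux_fourierInv_L2 (M φ) hint] with s hs
  rw [hs, Real.fourierInv_eq']
  -- the kernel
  have hKi : Integrable (fun s' : ℝ => ((K0 (κ * |s - s'|) : ℝ) : ℂ)) :=
    ((aux_K0_int κ hκ).comp_sub_left s).ofReal
  have hK2 : MemLp (fun s' : ℝ => ((K0 (κ * |s - s'|) : ℝ) : ℂ)) 2 (volume : Measure ℝ) := by
    rw [memLp_two_iff_integrable_sq_norm hKi.1]
    refine ((aux_K0_sq κ hκ).comp_sub_left s).congr (Filter.Eventually.of_forall fun x => ?_)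
    simp
  let k := hK2.toLp _
  have hk : (k : ℝ → ℂ) =ᵐ[volume] _ := hK2.coeFn_toLp
  have hki : Integrable (k : ℝ → ℂ) := hKi.congr hk.symm
  have e1 : ∫ s' : ℝ, (K0 (κ * |s - s'|) : ℂ) * ψ s' = inner ℂ k ψ := by
    rw [L2.inner_def]
    apply integral_congr_ae
    filter_upwards [hk] with x hx
    rw [hx]
    simp [mul_comm]
  have e2 : ∀ ξ : ℝ, FourierTransform.fourier (k : ℝ → ℂ) ξ =
      Complex.exp (-(2 * π * ξ * s : ℝ) * Complex.I) * (π * ((2 * π * ξ) ^ 2 + κ ^ 2) ^ (-(1 / 2) : ℝ) : ℝ) := by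
    intro ξ
    have hkft := aux_K0_ft κ (-(2 * π * ξ)) hκ
    rw [neg_sq] at hkft
    rw [← hkft, Real.fourier_eq', ← integral_const_mul, ← integral_sub_left_eq_self _ volume s]
    have hk' : ∀ᵐ x : ℝ, k x = ((K0 (κ * |s - x|) : ℝ) : ℂ) := hk
    have := (Measure.measurePreserving_sub_left (volume : Measure ℝ) s).quasiMeasurePreserving.ae hk'
    apply integral_congr_ae
    filter_upwards [this] with x hx
    rw [hx, sub_sub_cancel, smul_eq_mul, ← mul_assoc, ← Complex.exp_add]
    congr 2
    simp
    ring
  rw [e1, ← LinearIsometryEquiv.inner_map_map (Lp.fourierTransformₗᵢ ℝ ℂ) k ψ, ← hφ, L2.inner_def,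
    ← integral_const_mul]
  apply integral_congr_ae
  filter_upwards [aux_fourier_L2 k hki, hM φ] with ξ h1 h2
  rw [h1, h2, e2, hmdef, RCLike.inner_apply (_ : ℂ) (φ ξ), map_mul, Complex.conj_ofReal, ← Complex.exp_conj]
  have : (π : ℂ) ≠ 0 := by exact_mod_cast Real.pi_ne_zero
  have e3 : (starRingEnd ℂ) (-(2 * π * ξ * s : ℝ) * Complex.I) = ((2 * π * inner ℝ ξ s : ℝ) : ℂ) * Complex.I := by
    rw [map_mul, map_neg, Complex.conj_ofReal, Complex.conj_I, neg_mul_neg]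
    congr 2
    simp
    ring
  rw [e3, smul_eq_mul]
  push_cast
  field_simp

/-- **The straight-line Birman–Schwinger operator.** For `α, κ > 0`, the convolution operator
`R^κ_{α,γ₀}` on `L²(ℝ)` with kernel `(α/2π) K₀(κ|s−s'|)` is bounded; it is unitarily
equivalent under the (unitary) Fourier transform to multiplication by
`p ↦ (α/2)(p²+κ²)^{-1/2}`, and its spectrum is `[0, α/(2κ)]`. -/
theorem straight_line_birman_schwinger_operator
    (α κ : ℝ) (hα : 0 < α) (hκ : 0 < κ) :
    Integrable (fun s : ℝ => K0 (κ * |s|)) ∧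
    ∃ T : Lp ℂ 2 (volume : Measure ℝ) →L[ℂ] Lp ℂ 2 (volume : Measure ℝ),
      (∀ ψ : Lp ℂ 2 (volume : Measure ℝ),
        ∀ᵐ s : ℝ, (T ψ : ℝ → ℂ) s
          = (α / (2 * π) : ℝ) * ∫ s' : ℝ, (K0 (κ * |s - s'|) : ℂ) * ψ s') ∧
      (∃ U : Lp ℂ 2 (volume : Measure ℝ) ≃ₗᵢ[ℂ] Lp ℂ 2 (volume : Measure ℝ),
        (∀ ψ : Lp ℂ 2 (volume : Measure ℝ), Integrable (ψ : ℝ → ℂ) →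
          ∀ᵐ p : ℝ, (U ψ : ℝ → ℂ) p
            = ((2 * π : ℝ) ^ (-(1 / 2) : ℝ) : ℝ)
                * ∫ s : ℝ, Complex.exp (-Complex.I * p * s) * ψ s) ∧
        (∀ ψ : Lp ℂ 2 (volume : Measure ℝ),
          (U (T ψ) : ℝ → ℂ)
            =ᵐ[volume] fun p : ℝ =>
              ((α / 2) * (p ^ 2 + κ ^ 2) ^ (-(1 / 2) : ℝ) : ℝ) * (U ψ : ℝ → ℂ) p)) ∧
      spectrum ℂ T = Complex.ofReal '' Set.Icc 0 (α / (2 * κ)) := by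
  refine ⟨aux_K0_int κ hκ, ?_⟩
  let F := Lp.fourierTransformₗᵢ ℝ ℂ
  let m : ℝ → ℝ := fun ξ => (α / 2) * ((2 * π * ξ) ^ 2 + κ ^ 2) ^ (-(1 / 2) : ℝ)
  have hpos : ∀ p : ℝ, 0 < p ^ 2 + κ ^ 2 := fun p => by positivity
  have hmc : Continuous m :=
    continuous_const.mul (Continuous.rpow_const (by fun_prop) fun ξ => Or.inl (hpos _).ne')
  have hm0 : ∀ ξ, 0 < m ξ := fun ξ => mul_pos (by positivity) (Real.rpow_pos_of_pos (hpos _) _)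
  have hmeq : ∀ ξ, m ξ = (α / 2) / √((2 * π * ξ) ^ 2 + κ ^ 2) := by
    intro ξ
    simp only [m]
    rw [Real.rpow_neg (hpos _).le, ← Real.sqrt_eq_rpow, div_eq_mul_inv (α / 2)]
  have hmle : ∀ ξ, m ξ ≤ α / (2 * κ) := by
    intro ξ
    rw [hmeq, ← div_div]
    gcongr
    exact Real.le_sqrt_of_sq_le (by nlinarith [sq_nonneg (2 * π * ξ)])
  obtain ⟨M, hM⟩ := aux_mul (fun ξ => (m ξ : ℂ)) (by fun_prop) (α / (2 * κ)) (fun ξ => by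
    rw [Complex.norm_real, Real.norm_eq_abs, abs_of_pos (hm0 ξ)]; exact hmle ξ)
  have hm2 : MemLp (fun ξ => (m ξ : ℂ)) 2 (volume : Measure ℝ) := by
    rw [memLp_two_iff_integrable_sq_norm (by fun_prop)]
    have h1 : Integrable (fun ξ : ℝ => (α / (2 * κ)) ^ 2 * (1 + (2 * π / κ * ξ) ^ 2)⁻¹) :=
      (integrable_inv_one_add_sq.comp_mul_left' (by positivity : 2 * π / κ ≠ 0)).const_mul _
    refine h1.congr (Filter.Eventually.of_forall fun ξ => ?_)
    simp only
    rw [Complex.norm_real, Real.norm_eq_abs, sq_abs, hmeq, div_pow (α / 2), Real.sq_sqrt (hpos _).le]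
    have := (hpos (2 * π * ξ)).ne'
    field_simp
    ring
  let T : Lp ℂ 2 (volume : Measure ℝ) →L[ℂ] Lp ℂ 2 (volume : Measure ℝ) :=
    (F.symm.toContinuousLinearEquiv : Lp ℂ 2 (volume : Measure ℝ) →L[ℂ] Lp ℂ 2 (volume : Measure ℝ)) ∘L M ∘L
      (F.toContinuousLinearEquiv : Lp ℂ 2 (volume : Measure ℝ) →L[ℂ] Lp ℂ 2 (volume : Measure ℝ))
  have hT : ∀ ψ, T ψ = F.symm (M (F ψ)) := fun ψ => rfl
  refine ⟨T, ?_, ?_, ?_⟩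
  · exact aux_conv α κ hκ m (fun ξ => rfl) hm2 M hM
  · obtain ⟨D, hD⟩ := aux_dil (2 * π)⁻¹ (by positivity)
    have hpi : (0:ℝ) < 2 * π := by positivity
    have hq := aux_qmp (2 * π)⁻¹ (by positivity)
    refine ⟨F.trans D, ?_, ?_⟩
    · intro ψ hψ
      filter_upwards [hD (F ψ), hq.ae (aux_fourier_L2 ψ hψ)] with p h1 h2
      change D (F ψ) p = _
      rw [h1]
      erw [h2]
      rw [Real.fourier_eq']
      congr 1
      · rw [Real.sqrt_inv, Real.rpow_neg hpi.le, Real.sqrt_eq_rpow]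
      · congr 1; ext s
        rw [smul_eq_mul]
        congr 2
        simp
        have : (π : ℂ) ≠ 0 := by exact_mod_cast Real.pi_ne_zero
        field_simp
    · intro ψ
      change (D (F (T ψ)) : ℝ → ℂ) =ᵐ[volume] fun p => _ * (D (F ψ) : ℝ → ℂ) p
      rw [hT, LinearIsometryEquiv.apply_symm_apply]
      filter_upwards [hD (M (F ψ)), hD (F ψ), hq.ae (hM (F ψ))] with p h1 h2 h3
      rw [h1, h2, h3]
      have : m ((2 * π)⁻¹ * p) = (α / 2) * (p ^ 2 + κ ^ 2) ^ (-(1 / 2) : ℝ) := by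
        simp only [m]
        rw [mul_inv_cancel_left₀ hpi.ne']
      rw [this]; ring
  · have hs : spectrum ℂ T = spectrum ℂ M := by
      have := AlgEquiv.spectrum_eq (F.symm.toContinuousLinearEquiv.conjContinuousAlgEquiv.toAlgEquiv) M
      rw [← this]
      rfl
    rw [hs, aux_spec _ (by fun_prop) M hM]
    have hr : Set.range (fun ξ => (m ξ : ℂ)) = Complex.ofReal '' (Set.range m) := by
      rw [← Set.range_comp]; rfl
    have hcl : closure (Complex.ofReal '' (Set.range m)) = Complex.ofReal '' (closure (Set.range m)) :=
      (Complex.isometry_ofReal.isClosedEmbedding.closure_image_eq _)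
    rw [hr, hcl]
    congr 1
    apply Set.Subset.antisymm
    · apply closure_minimal _ isClosed_Icc
      rintro _ ⟨ξ, rfl⟩
      exact ⟨(hm0 ξ).le, hmle ξ⟩
    · rw [← closure_Ioc (by positivity : (0:ℝ) ≠ α / (2 * κ))]
      apply closure_mono
      rintro y ⟨hy0, hy1⟩
      refine ⟨√((α / (2 * y)) ^ 2 - κ ^ 2) / (2 * π), ?_⟩
      have hk : κ ≤ α / (2 * y) := by
        rw [le_div_iff₀ (by positivity)] at hy1 ⊢
        linarith
      have hnn : 0 ≤ (α / (2 * y)) ^ 2 - κ ^ 2 := by nlinarith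
      rw [hmeq, mul_div_cancel₀ _ (by positivity : (2 * π) ≠ 0), Real.sq_sqrt hnn, sub_add_cancel,
        Real.sqrt_sq (by positivity)]
      field_simp
end
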